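/- For every ω ∈ (-1,1), define V₁(z) = −3(1−ω²)/(ω + cosh 2z)² − 6ω/(ω + cosh 2z) and V₂(z) = −6ω (1 + ω cosh 2z + i√(1−ω²) sinh 2z)² / (ω + cosh 2z)³, and let φ₀(z) = ( ω sinh 2z + i√(1−ω²) cosh 2z ) / (ω + cosh 2z)^{3/2}. Then −φ₀''(z) + (1 + V₁(z)) φ₀(z) + V₂(z) conj(φ₀(z)) = 0 for all z ∈ ℝ; i.e. (φ₀, conj(φ₀)) is an eigenvector with eigenvalue λ = 0 of the coupled spectral problem with diagonal part −∂_z² + 1 + V₁ and off-diagonal part V₂. -/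

import Mathlib

open Complex

lemma hasDerivAt_sinh_two_mul (z : ℝ) :
    HasDerivAt (fun x : ℝ => Real.sinh (2 * x)) (2 * Real.cosh (2 * z)) z := by
  simpa [mul_comm] using ((hasDerivAt_id z).const_mul 2).sinh

lemma hasDerivAt_cosh_two_mul (z : ℝ) :
    HasDerivAt (fun x : ℝ => Real.cosh (2 * x)) (2 * Real.sinh (2 * z)) z := by
  simpa [mul_comm] using ((hasDerivAt_id z).const_mul 2).cosh

lemma hasDerivAt_linear_sinh_cosh (a b : ℂ) (z : ℝ) :
    HasDerivAt (fun x : ℝ => a * (Real.sinh (2 * x) : ℂ) + b * (Real.cosh (2 * x) : ℂ))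
      (2 * (a * (Real.cosh (2 * z) : ℂ) + b * (Real.sinh (2 * z) : ℂ))) z := by
  refine (((hasDerivAt_sinh_two_mul z).ofReal_comp.const_mul a).add
    ((hasDerivAt_cosh_two_mul z).ofReal_comp.const_mul b)).congr_deriv ?_
  push_cast
  ring

lemma add_cosh_pos {ω : ℝ} (hω : -1 < ω) (z : ℝ) : 0 < ω + Real.cosh z := by
  linarith [Real.one_le_cosh z]

lemma hasDerivAt_rpow_add_cosh {ω : ℝ} (hω : -1 < ω) (p z : ℝ) :
    HasDerivAt (fun x : ℝ => (((ω + Real.cosh (2 * x)) ^ p : ℝ) : ℂ))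
      (2 * p * (Real.sinh (2 * z) : ℂ) * (((ω + Real.cosh (2 * z)) ^ (p - 1) : ℝ) : ℂ)) z := by
  refine (((hasDerivAt_cosh_two_mul z).const_add ω).rpow_const
    (Or.inl (add_cosh_pos hω (2 * z)).ne')).ofReal_comp.congr_deriv ?_
  push_cast
  ring

/-- The second derivative of `(a sinh 2z + b cosh 2z) (ω + cosh 2z)^(-3/2)`. -/
lemma deriv_deriv_sinh_cosh_mul_rpow {ω : ℝ} (hω : -1 < ω) (a b : ℂ) (z : ℝ) :
    deriv (deriv fun x : ℝ => (a * (Real.sinh (2 * x) : ℂ) + b * (Real.cosh (2 * x) : ℂ)) *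
        (((ω + Real.cosh (2 * x)) ^ (-(3 / 2) : ℝ) : ℝ) : ℂ)) z =
      (4 * (a * (Real.sinh (2 * z) : ℂ) + b * (Real.cosh (2 * z) : ℂ)) * (ω + Real.cosh (2 * z)) ^ 2
        - 12 * (Real.sinh (2 * z) : ℂ) *
          (a * (Real.cosh (2 * z) : ℂ) + b * (Real.sinh (2 * z) : ℂ)) * (ω + Real.cosh (2 * z))
        - 6 * (Real.cosh (2 * z) : ℂ) *
          (a * (Real.sinh (2 * z) : ℂ) + b * (Real.cosh (2 * z) : ℂ)) * (ω + Real.cosh (2 * z))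
        + 15 * (Real.sinh (2 * z) : ℂ) ^ 2 *
          (a * (Real.sinh (2 * z) : ℂ) + b * (Real.cosh (2 * z) : ℂ))) *
      (((ω + Real.cosh (2 * z)) ^ (-(7 / 2) : ℝ) : ℝ) : ℂ) := by
  have hfirst := funext fun x : ℝ =>
    ((hasDerivAt_linear_sinh_cosh a b x).mul (hasDerivAt_rpow_add_cosh hω (-(3 / 2)) x)).deriv
  have hsecond := (((hasDerivAt_linear_sinh_cosh b a z).const_mul 2).mul
      (hasDerivAt_rpow_add_cosh hω (-(3 / 2)) z)).add
    ((hasDerivAt_linear_sinh_cosh a b z).mul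
      (((hasDerivAt_sinh_two_mul z).ofReal_comp.const_mul (2 * ((-(3 / 2) : ℝ) : ℂ))).mul
        (hasDerivAt_rpow_add_cosh hω (-(3 / 2) - 1) z)))
  have hD := add_cosh_pos hω (2 * z)
  have hpow₁ : (ω + Real.cosh (2 * z)) ^ (-(3 / 2) - 1 : ℝ) =
      (ω + Real.cosh (2 * z)) ^ (-(7 / 2) : ℝ) * (ω + Real.cosh (2 * z)) := by
    rw [← Real.rpow_add_one hD.ne']
    norm_num
  have hpow₂ : (ω + Real.cosh (2 * z)) ^ (-(3 / 2) : ℝ) =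
      (ω + Real.cosh (2 * z)) ^ (-(7 / 2) : ℝ) * (ω + Real.cosh (2 * z)) ^ 2 := by
    rw [← Real.rpow_natCast, ← Real.rpow_add hD]
    norm_num
  have hpow₃ : (-(3 / 2) - 1 - 1 : ℝ) = -(7 / 2) := by norm_num
  refine (congrArg (fun f => deriv f z) hfirst).trans ?_
  refine ((hsecond.congr_of_eventuallyEq (.of_forall fun x => ?_)).deriv).trans ?_
  · simp only [Pi.add_apply, Pi.mul_apply]
    ring
  · simp only [Pi.mul_apply, hpow₃, hpow₁, hpow₂]
    push_cast
    ring

theorem stmt12 (ω : ℝ) (hω₁ : -1 < ω) (hω₂ : ω < 1)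
    (V₁ : ℝ → ℝ) (V₂ : ℝ → ℂ) (φ₀ : ℝ → ℂ)
    (hV₁ : ∀ z, V₁ z = -3 * (1 - ω ^ 2) / (ω + Real.cosh (2 * z)) ^ 2
        - 6 * ω / (ω + Real.cosh (2 * z)))
    (hV₂ : ∀ z, V₂ z = -6 * (ω : ℂ) *
        (((1 + ω * Real.cosh (2 * z) : ℝ) : ℂ) +
          Complex.I * ((Real.sqrt (1 - ω ^ 2) * Real.sinh (2 * z) : ℝ) : ℂ)) ^ 2 /
        (((ω + Real.cosh (2 * z) : ℝ) : ℂ)) ^ 3)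
    (hφ₀ : ∀ z, φ₀ z = (((ω * Real.sinh (2 * z) : ℝ) : ℂ) +
          Complex.I * ((Real.sqrt (1 - ω ^ 2) * Real.cosh (2 * z) : ℝ) : ℂ)) /
        (((ω + Real.cosh (2 * z)) ^ ((3 : ℝ) / 2) : ℝ) : ℂ)) :
    ∀ z : ℝ,
      -deriv (deriv φ₀) z + ((1 + V₁ z : ℝ) : ℂ) * φ₀ z
          + V₂ z * (starRingEnd ℂ) (φ₀ z) = 0 := by
  intro z
  have hφ : φ₀ = fun x : ℝ =>
      ((ω : ℂ) * (Real.sinh (2 * x) : ℂ) +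
        I * (Real.sqrt (1 - ω ^ 2) : ℂ) * (Real.cosh (2 * x) : ℂ)) *
        (((ω + Real.cosh (2 * x)) ^ (-(3 / 2) : ℝ) : ℝ) : ℂ) := by
    funext x
    rw [hφ₀, Real.rpow_neg (add_cosh_pos hω₁ (2 * x)).le]
    push_cast
    ring
  have hD := add_cosh_pos hω₁ (2 * z)
  have hpow : (ω + Real.cosh (2 * z)) ^ (-(3 / 2) : ℝ) =
      (ω + Real.cosh (2 * z)) ^ (-(7 / 2) : ℝ) * (ω + Real.cosh (2 * z)) ^ 2 := by
    rw [← Real.rpow_natCast, ← Real.rpow_add hD]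
    norm_num
  have hs : (Real.sqrt (1 - ω ^ 2) : ℂ) ^ 2 = 1 - (ω : ℂ) ^ 2 := by
    exact_mod_cast Real.sq_sqrt (by nlinarith : 0 ≤ 1 - ω ^ 2)
  have hS : (Real.sinh (2 * z) : ℂ) ^ 2 = (Real.cosh (2 * z) : ℂ) ^ 2 - 1 := by
    exact_mod_cast Real.sinh_sq (2 * z)
  have hDc : (ω : ℂ) + (Real.cosh (2 * z) : ℂ) ≠ 0 := by exact_mod_cast hD.ne'
  have hI := I_sq
  rw [hV₁, hV₂, hφ, deriv_deriv_sinh_cosh_mul_rpow hω₁]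
  simp only [hpow, map_mul, map_add, map_pow, conj_ofReal, conj_I, ofReal_add, ofReal_sub, ofReal_mul, ofReal_div,
    ofReal_pow, ofReal_neg, ofReal_one, ofReal_ofNat]
  generalize (((ω + Real.cosh (2 * z)) ^ (-(7 / 2) : ℝ) : ℝ) : ℂ) = E
  generalize (Real.sqrt (1 - ω ^ 2) : ℂ) = s at *
  generalize (Real.sinh (2 * z) : ℂ) = S at *
  generalize (Real.cosh (2 * z) : ℂ) = C at *
  generalize (ω : ℂ) = w at *
  clear hV₁ hV₂ hφ₀ hφ hpow hD
  generalize I = i at *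
  field_simp
  grind
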